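/- arXiv:2511.18503 — 7 statements merged into one kernel-verified Lean document; each statement's English description precedes it below -/
import Mathlib

section
/- Let r₁, r₂ : ℍ ≃ᵢ ℍ be isometries of the hyperbolic plane such that rᵢ ∘ rᵢ is the identity and the fixed-point set of rᵢ is exactly {vᵢ} (i = 1, 2), with v₁ ≠ v₂. Let g = r₂ ∘ r₁. Then dist(v₁, g v₁) = 2 · dist(v₁, v₂), and for every z ∈ ℍ one has dist(z, g z) ≥ 2 · dist(v₁, v₂). In particular the infimum of the displacement function z ↦ dist(z, g z) equals 2 · dist(v₁, v₂), is attained, and is positive, i.e. g is a hyperbolic isometry with translation length 2 · dist(v₁, v₂). -/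
open UpperHalfPlane

open Real in
/-- Any two points of the hyperbolic plane have a midpoint, which satisfies the median formula. -/
theorem UpperHalfPlane.exists_cosh_dist_median (x y : ℍ) :
    ∃ m : ℍ, ∀ p : ℍ, 2 * cosh (dist x y / 2) * cosh (dist m p) =
      cosh (dist x p) + cosh (dist y p) := by
  have hx := x.im_pos
  have hy := y.im_pos
  have hc : 4 * cosh (dist x y / 2) ^ 2 * (x.im * y.im) =
      (x.re - y.re) ^ 2 + (x.im + y.im) ^ 2 := by
    have h := cosh_two_mul (dist x y / 2)
    rw [mul_div_cancel₀ _ two_ne_zero, cosh_dist', sinh_sq] at h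
    field_simp at h
    linarith
  have hpos := cosh_pos (dist x y / 2)
  set c := cosh (dist x y / 2)
  refine ⟨⟨⟨(x.re * y.im + y.re * x.im) / (x.im + y.im),
    2 * c * (x.im * y.im) / (x.im + y.im)⟩, by positivity⟩, fun p => ?_⟩
  have hp := p.im_pos
  simp only [cosh_dist', UpperHalfPlane.re, UpperHalfPlane.im] at *
  field_simp
  linear_combination (x : ℂ).im * (y : ℂ).im * hc

open Real in
/-- The center of a half-turn satisfies the median formula for a point and its image. -/
theorem IsometryEquiv.cosh_dist_center (r : ℍ ≃ᵢ ℍ) (v : ℍ) (hinv : ⇑r ∘ ⇑r = id)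
    (hfix : {p : ℍ | r p = p} = {v}) (z p : ℍ) :
    2 * cosh (dist z (r z) / 2) * cosh (dist v p) = cosh (dist z p) + cosh (dist (r z) p) := by
  obtain ⟨m, hm⟩ := exists_cosh_dist_median z (r z)
  have hr (w : ℍ) : r (r w) = w := congrFun hinv w
  have h₁ : dist z (r m) = dist (r z) m := by rw [← r.dist_eq, hr]
  have h₂ : dist (r z) (r m) = dist z m := r.dist_eq _ _
  have h₃ : cosh (dist m (r m)) = cosh (dist m m) := by
    refine mul_left_cancel₀ (mul_pos two_pos (cosh_pos (dist z (r z) / 2))).ne' ?_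
    rw [hm, hm, h₁, h₂, add_comm]
  have h₄ : dist m (r m) = 0 := by
    rw [dist_self, cosh_zero] at h₃
    by_contra h
    exact (one_lt_cosh.2 h).ne' h₃
  have hmv : m = v := by
    have : m ∈ {p : ℍ | r p = p} := (dist_eq_zero.1 h₄).symm
    rwa [hfix] at this
  exact hmv ▸ hm p

open Real in
/-- The center of a half-turn is equidistant from a point and its image, at half their distance. -/
theorem IsometryEquiv.dist_self_apply_eq_two_mul (r : ℍ ≃ᵢ ℍ) (v : ℍ) (hinv : ⇑r ∘ ⇑r = id)
    (hfix : {p : ℍ | r p = p} = {v}) (z : ℍ) : dist z (r z) = 2 * dist z v := by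
  have h := r.cosh_dist_center v hinv hfix z z
  have h₂ := cosh_two_mul (dist z (r z) / 2)
  rw [mul_div_cancel₀ _ two_ne_zero, sinh_sq] at h₂
  rw [dist_self, cosh_zero, dist_comm (r z), h₂] at h
  have h₃ : cosh (dist v z) = cosh (dist z (r z) / 2) :=
    mul_left_cancel₀ (mul_pos two_pos (cosh_pos (dist z (r z) / 2))).ne' (by linarith)
  have h₄ := cosh_strictMonoOn.injOn (Set.mem_Ici.2 dist_nonneg)
    (Set.mem_Ici.2 (by positivity)) h₃
  rw [dist_comm z v, h₄]
  ring

/-- An inequality between the hyperbolic cosines of numbers satisfying the triangle inequalities. -/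
theorem Real.cosh_sq_add_cosh_sq_add_cosh_sq_le {a b c : ℝ} (hc : c ≤ a + b) (h : |a - b| ≤ c) :
    cosh a ^ 2 + cosh b ^ 2 + cosh c ^ 2 ≤ 1 + 2 * cosh a * cosh b * cosh c := by
  have hc0 : 0 ≤ c := (abs_nonneg _).trans h
  have h₁ : cosh c ≤ cosh (a + b) := by
    rw [cosh_le_cosh, abs_of_nonneg hc0]
    exact hc.trans (le_abs_self _)
  have h₂ : cosh (a - b) ≤ cosh c := by
    rwa [cosh_le_cosh, abs_of_nonneg hc0]
  rw [cosh_add] at h₁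
  rw [cosh_sub] at h₂
  have h₃ := mul_nonneg (sub_nonneg.2 h₁) (sub_nonneg.2 h₂)
  have ha := cosh_sq a
  have hb := cosh_sq b
  have key : (sinh a * sinh b) ^ 2 = (cosh a ^ 2 - 1) * (cosh b ^ 2 - 1) := by
    rw [ha, hb]; ring
  linarith

open Real in
/-- A product of two half-turns displaces every point by at least twice the distance between the
centers. -/
theorem IsometryEquiv.two_mul_dist_center_le (r₁ r₂ : ℍ ≃ᵢ ℍ) (v₁ v₂ : ℍ)
    (hinv₁ : ⇑r₁ ∘ ⇑r₁ = id) (hinv₂ : ⇑r₂ ∘ ⇑r₂ = id)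
    (hfix₁ : {p : ℍ | r₁ p = p} = {v₁}) (hfix₂ : {p : ℍ | r₂ p = p} = {v₂}) (z : ℍ) :
    2 * dist v₁ v₂ ≤ dist z (r₂ (r₁ z)) := by
  have e₁ := r₁.cosh_dist_center v₁ hinv₁ hfix₁ z v₂
  have e₂ := r₂.cosh_dist_center v₂ hinv₂ hfix₂ (r₁ z) z
  have e₃ := r₂.dist_self_apply_eq_two_mul v₂ hinv₂ hfix₂ (r₁ z)
  set a := r₁ z
  set b := r₂ a
  have e₄ : dist a v₂ = dist a b / 2 := by linarith
  rw [e₄, dist_comm z v₂] at e₁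
  rw [dist_comm a z, dist_comm b z] at e₂
  have t₁ := dist_triangle z a b
  have t₂ := dist_triangle z b a
  have t₃ := dist_triangle a z b
  rw [dist_comm b a] at t₂
  rw [dist_comm a z] at t₃
  have tri := cosh_sq_add_cosh_sq_add_cosh_sq_le (a := dist z a / 2) (b := dist a b / 2)
    (c := dist z b / 2) (by linarith) (abs_le.2 ⟨by linarith, by linarith⟩)
  have cosh_eq (t : ℝ) : cosh t = 2 * cosh (t / 2) ^ 2 - 1 := by
    have h := cosh_two_mul (t / 2)
    rw [mul_div_cancel₀ _ two_ne_zero, sinh_sq] at h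
    linarith
  rw [cosh_eq (dist z a), cosh_eq (dist z b)] at e₂
  have hα := cosh_pos (dist z a / 2)
  have hβ := cosh_pos (dist a b / 2)
  have h : cosh (dist v₁ v₂) ≤ cosh (dist z b / 2) := by
    refine le_of_mul_le_mul_left ?_ (mul_pos hα hβ)
    linear_combination (1 / 2 : ℝ) * cosh (dist a b / 2) * e₁ + (1 / 4 : ℝ) * e₂ + tri / 2
  rw [cosh_le_cosh, abs_of_nonneg dist_nonneg, abs_of_nonneg (by positivity)] at h
  linarith

/-- The composition of two half-turns of the hyperbolic plane about distinct points
`v₁ ≠ v₂` is a hyperbolic isometry with translation length `2 * dist v₁ v₂`: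
the displacement of `v₁` is exactly `2 * dist v₁ v₂`, every point is displaced by at
least that amount, and hence the infimum of the displacement function is
`2 * dist v₁ v₂`, is attained, and is positive. -/
theorem halfTurn_comp_hyperbolic (r₁ r₂ : ℍ ≃ᵢ ℍ) (v₁ v₂ : ℍ)
    (hinv₁ : (⇑r₁) ∘ (⇑r₁) = id) (hinv₂ : (⇑r₂) ∘ (⇑r₂) = id)
    (hfix₁ : {p : ℍ | r₁ p = p} = {v₁}) (hfix₂ : {p : ℍ | r₂ p = p} = {v₂})
    (hne : v₁ ≠ v₂) :
    dist v₁ (r₂ (r₁ v₁)) = 2 * dist v₁ v₂ ∧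
    (∀ z : ℍ, 2 * dist v₁ v₂ ≤ dist z (r₂ (r₁ z))) ∧
    (⨅ z : ℍ, dist z (r₂ (r₁ z))) = 2 * dist v₁ v₂ ∧
    (∃ z : ℍ, dist z (r₂ (r₁ z)) = 2 * dist v₁ v₂) ∧
    0 < 2 * dist v₁ v₂ := by
  have hle := r₁.two_mul_dist_center_le r₂ v₁ v₂ hinv₁ hinv₂ hfix₁ hfix₂
  have hv : r₁ v₁ = v₁ := by
    have : v₁ ∈ {p : ℍ | r₁ p = p} := hfix₁ ▸ rfl
    exact this
  have heq : dist v₁ (r₂ (r₁ v₁)) = 2 * dist v₁ v₂ := by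
    rw [hv, r₂.dist_self_apply_eq_two_mul v₂ hinv₂ hfix₂]
  refine ⟨heq, hle, le_antisymm ?_ (le_ciInf hle), ⟨v₁, heq⟩,
    mul_pos two_pos (dist_pos.2 hne)⟩
  exact (ciInf_le ⟨_, Set.forall_mem_range.2 hle⟩ v₁).trans_eq heq
end

section
/- Let r₁, r₂ : ℍ ≃ᵢ ℍ be isometries of the hyperbolic plane such that rᵢ ∘ rᵢ is the identity and the fixed-point set of rᵢ is exactly {vᵢ} (i = 1, 2), with v₁ ≠ v₂, and let g = r₂ ∘ r₁. Then there exists an isometric embedding γ : ℝ → ℍ (i.e., a map γ with Isometry γ) such that v₁ and v₂ lie in the range of γ and the set {z ∈ ℍ | dist(z, g z) = 2 · dist(v₁, v₂)} of points realizing the minimal displacement of g is exactly the range of γ. -/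
open UpperHalfPlane

/-- The hyperboloid model: `ℍ` is identified with the sheet `0 < a`, `a * c - b ^ 2 = 1`, and
`cosh (dist p q)` is the associated bilinear form. -/
lemma exists_hyperboloid_coordinates : ∃ A B C : ℍ → ℝ,
    (∀ p, 0 < A p) ∧ (∀ p, A p * C p - B p ^ 2 = 1) ∧
    (∀ p q, Real.cosh (dist p q) = (A p * C q + C p * A q) / 2 - B p * B q) ∧
    ∀ a b c : ℝ, 0 < a → a * c - b ^ 2 = 1 → ∃ m, A m = a ∧ B m = b ∧ C m = c := by
  refine ⟨fun p ↦ 1 / p.im, fun p ↦ p.re / p.im, fun p ↦ (p.re ^ 2 + p.im ^ 2) / p.im,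
    fun p ↦ one_div_pos.2 p.im_pos, fun p ↦ ?_, fun p q ↦ ?_, fun a b c ha h ↦ ?_⟩
  · have := p.im_ne_zero
    field_simp
    ring
  · have := p.im_ne_zero
    have := q.im_ne_zero
    rw [UpperHalfPlane.cosh_dist']
    field_simp
    ring
  · refine ⟨⟨⟨b / a, 1 / a⟩, one_div_pos.2 ha⟩, ?_, ?_, ?_⟩
    · change 1 / (1 / a) = a
      field_simp
    · change b / a / (1 / a) = b
      field_simp
    · change ((b / a) ^ 2 + (1 / a) ^ 2) / (1 / a) = c
      field_simp
      linarith

lemma eq_of_cosh_dist_eq_one {X : Type*} [MetricSpace X] {p q : X}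
    (h : Real.cosh (dist p q) = 1) : p = q := by
  by_contra hpq
  exact (Real.one_lt_cosh.2 (dist_ne_zero.2 hpq)).ne' h

/-- Existence of midpoints in `ℍ`, characterized by the median formula. -/
lemma exists_midpoint (p q : ℍ) : ∃ m : ℍ, ∀ s, Real.cosh (dist p s) + Real.cosh (dist q s) =
    2 * Real.cosh (dist p m) * Real.cosh (dist m s) := by
  obtain ⟨A, B, C, hA, hABC, hd, hex⟩ := exists_hyperboloid_coordinates
  obtain ⟨k, hk, hk2⟩ : ∃ k : ℝ, 0 < k ∧ 4 * k ^ 2 = 2 * (1 + Real.cosh (dist p q)) := by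
    refine ⟨Real.cosh (dist p q / 2), Real.cosh_pos _, ?_⟩
    have h := Real.cosh_two_mul (dist p q / 2)
    rw [mul_div_cancel₀ _ two_ne_zero, Real.sinh_sq] at h
    linarith
  rw [hd] at hk2
  have hp := hABC p
  have hq := hABC q
  obtain ⟨m, hmA, hmB, hmC⟩ := hex ((A p + A q) / (2 * k)) ((B p + B q) / (2 * k))
    ((C p + C q) / (2 * k)) (div_pos (add_pos (hA p) (hA q)) (by positivity)) (by
      field_simp
      linarith)
  have hpm : Real.cosh (dist p m) = k := by
    rw [hd, hmA, hmB, hmC]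
    field_simp
    linarith
  refine ⟨m, fun s ↦ ?_⟩
  rw [hpm, hd p, hd q, hd m, hmA, hmB, hmC]
  field_simp
  ring

/-- The center of a half-turn is the midpoint of every point and its image. -/
lemma cosh_dist_add_cosh_dist_halfTurn {r : ℍ ≃ᵢ ℍ} {v : ℍ} (hinv : (⇑r) ∘ (⇑r) = id)
    (hfix : {p : ℍ | r p = p} = {v}) (p s : ℍ) :
    Real.cosh (dist p s) + Real.cosh (dist (r p) s) =
      2 * Real.cosh (dist p v) * Real.cosh (dist v s) := by
  have hrr : ∀ x, r (r x) = x := congrFun hinv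
  obtain ⟨m, hm⟩ := exists_midpoint p (r p)
  have hmm := hm m
  rw [dist_self, Real.cosh_zero] at hmm
  have hmr := hm (r m)
  have h : dist p (r m) = dist (r p) m := by rw [← r.dist_eq p (r m), hrr]
  rw [r.dist_eq, h] at hmr
  have hpos := Real.cosh_pos (dist p m)
  have hmv : m = r m := eq_of_cosh_dist_eq_one <| by
    refine mul_left_cancel₀ (mul_pos two_pos hpos).ne' ?_
    linarith
  have : m = v := by
    rw [← Set.mem_singleton_iff, ← hfix]
    exact hmv.symm
  rw [← this, hm s]

/-- A unit speed parametrization of the line through two distinct points of `ℍ`, determined by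
its distances to all points. -/
lemma exists_line_param {v w : ℍ} (hne : v ≠ w) : ∃ γ : ℝ → ℍ, ∀ t z,
    Real.cosh (dist (γ t) z) = Real.cosh t * Real.cosh (dist v z) +
      Real.sinh t * ((Real.cosh (dist w z) - Real.cosh (dist v w) * Real.cosh (dist v z)) /
        Real.sinh (dist v w)) := by
  obtain ⟨A, B, C, hA, hABC, hd, hex⟩ := exists_hyperboloid_coordinates
  have hS : 0 < Real.sinh (dist v w) := Real.sinh_pos_iff.2 (dist_pos.2 hne)
  have hCS := Real.cosh_sq (dist v w)
  have hvw := hd v w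
  set K := Real.cosh (dist v w)
  set S := Real.sinh (dist v w)
  have hv := hABC v
  have hw := hABC w
  obtain ⟨a, ha⟩ : ∃ a, a = (A w - K * A v) / S := ⟨_, rfl⟩
  obtain ⟨b, hb⟩ : ∃ b, b = (B w - K * B v) / S := ⟨_, rfl⟩
  obtain ⟨c, hc⟩ : ∃ c, c = (C w - K * C v) / S := ⟨_, rfl⟩
  have hunit : a * c - b ^ 2 = -1 := by
    rw [ha, hb, hc]
    field_simp
    linear_combination hw + K ^ 2 * hv + 2 * K * hvw - hCS
  have horth : A v * c + C v * a = 2 * B v * b := by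
    rw [ha, hb, hc]
    field_simp
    linear_combination (-2) * hvw - 2 * K * hv
  have haA : a ^ 2 ≤ A v ^ 2 := by
    have : a ^ 2 + (a * B v - b * A v) ^ 2 = A v ^ 2 := by
      linear_combination a * A v * horth - A v ^ 2 * hunit - a ^ 2 * hv
    nlinarith [sq_nonneg (a * B v - b * A v)]
  have key : ∀ t : ℝ, ∃ m, A m = Real.cosh t * A v + Real.sinh t * a ∧
      B m = Real.cosh t * B v + Real.sinh t * b ∧ C m = Real.cosh t * C v + Real.sinh t * c := by
    intro t
    have ht := Real.cosh_sq t
    refine hex _ _ _ ?_ ?_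
    · have hlt : |Real.sinh t * a| < Real.cosh t * A v := by
        refine abs_lt_of_sq_lt_sq ?_ (mul_pos (Real.cosh_pos t) (hA v)).le
        rw [mul_pow, mul_pow, ht]
        have := mul_le_mul_of_nonneg_left haA (sq_nonneg (Real.sinh t))
        have := pow_pos (hA v) 2
        linarith
      linarith [(abs_lt.1 hlt).1]
    · linear_combination Real.cosh t ^ 2 * hv + Real.sinh t ^ 2 * hunit +
        Real.cosh t * Real.sinh t * horth + ht
  choose γ hγA hγB hγC using key
  refine ⟨γ, fun t z ↦ ?_⟩
  rw [hd (γ t), hγA, hγB, hγC, hd v z, hd w z, ha, hb, hc]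
  field_simp
  ring

/-- Two distinct points of `ℍ` lie on a geodesic line, consisting of the points `z` for which the
Gram determinant of the representatives of `v`, `w`, `z` on the hyperboloid vanishes. -/
lemma exists_isometry_range_eq {v w : ℍ} (hne : v ≠ w) : ∃ γ : ℝ → ℍ, Isometry γ ∧
    v ∈ Set.range γ ∧ w ∈ Set.range γ ∧ ∀ z, z ∈ Set.range γ ↔
      (Real.cosh (dist w z) - Real.cosh (dist v w) * Real.cosh (dist v z)) ^ 2 =
        (Real.cosh (dist v w) ^ 2 - 1) * (Real.cosh (dist v z) ^ 2 - 1) := by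
  obtain ⟨γ, hγ⟩ := exists_line_param hne
  have hS : 0 < Real.sinh (dist v w) := Real.sinh_pos_iff.2 (dist_pos.2 hne)
  have hCS := Real.cosh_sq (dist v w)
  have hv : ∀ t, Real.cosh (dist v (γ t)) = Real.cosh t := fun t ↦ by
    rw [dist_comm, hγ, dist_self, dist_comm w v]
    simp
  have hw : ∀ t, Real.cosh (dist w (γ t)) =
      Real.cosh (dist v w) * Real.cosh t - Real.sinh (dist v w) * Real.sinh t := fun t ↦ by
    rw [dist_comm, hγ, dist_self, Real.cosh_zero]
    field_simp
    linear_combination (-Real.sinh t) * hCS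
  refine ⟨γ, Isometry.of_dist_eq fun s t ↦ ?_, ⟨0, ?_⟩, ⟨dist v w, ?_⟩, fun z ↦ ⟨?_, fun h ↦ ?_⟩⟩
  · have h : Real.cosh (dist (γ s) (γ t)) = Real.cosh (dist s t) := by
      rw [hγ, hv, hw, Real.dist_eq, Real.cosh_abs, Real.cosh_sub]
      field_simp
      ring
    exact Real.cosh_strictMonoOn.injOn dist_nonneg dist_nonneg h
  · refine eq_of_cosh_dist_eq_one ?_
    rw [hγ, dist_self]
    simp
  · refine eq_of_cosh_dist_eq_one ?_
    rw [hγ, dist_self, Real.cosh_zero]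
    field_simp
    ring
  · rintro ⟨t, rfl⟩
    rw [hv, hw, hCS, Real.cosh_sq t]
    ring
  · have hα := Real.cosh_sq (dist v z)
    have h' : (Real.cosh (dist w z) - Real.cosh (dist v w) * Real.cosh (dist v z)) ^ 2 =
        (Real.sinh (dist v w) * Real.sinh (dist v z)) ^ 2 := by
      rw [h, hCS, hα]
      ring
    rcases sq_eq_sq_iff_eq_or_eq_neg.1 h' with h' | h'
    · refine ⟨-dist v z, eq_of_cosh_dist_eq_one ?_⟩
      rw [hγ, h', Real.cosh_neg, Real.sinh_neg]
      field_simp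
      linarith
    · refine ⟨dist v z, eq_of_cosh_dist_eq_one ?_⟩
      rw [hγ, h']
      field_simp
      linarith

/-- The axis of the composition of two half-turns about distinct points `v₁ ≠ v₂` of the
hyperbolic plane: there is a geodesic line (the range of an isometric embedding
`γ : ℝ → ℍ`) through `v₁` and `v₂` which is exactly the set of points realizing the
minimal displacement `2 * dist v₁ v₂` of the hyperbolic isometry `r₂ ∘ r₁`. -/
theorem halfTurn_comp_axis (r₁ r₂ : ℍ ≃ᵢ ℍ) (v₁ v₂ : ℍ)
    (hinv₁ : (⇑r₁) ∘ (⇑r₁) = id) (hinv₂ : (⇑r₂) ∘ (⇑r₂) = id)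
    (hfix₁ : {p : ℍ | r₁ p = p} = {v₁}) (hfix₂ : {p : ℍ | r₂ p = p} = {v₂})
    (hne : v₁ ≠ v₂) :
    ∃ γ : ℝ → ℍ, Isometry γ ∧ v₁ ∈ Set.range γ ∧ v₂ ∈ Set.range γ ∧
      {z : ℍ | dist z (r₂ (r₁ z)) = 2 * dist v₁ v₂} = Set.range γ := by
  obtain ⟨γ, hγ, h₁, h₂, hrange⟩ := exists_isometry_range_eq hne
  refine ⟨γ, hγ, h₁, h₂, Set.ext fun z ↦ ?_⟩
  have e₁ := cosh_dist_add_cosh_dist_halfTurn hinv₁ hfix₁ z z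
  have e₂ := cosh_dist_add_cosh_dist_halfTurn hinv₁ hfix₁ z v₂
  have e₃ := cosh_dist_add_cosh_dist_halfTurn hinv₂ hfix₂ (r₁ z) z
  have hdouble := Real.cosh_two_mul (dist v₁ v₂)
  rw [Real.sinh_sq] at hdouble
  rw [dist_self, Real.cosh_zero, dist_comm z v₁] at e₁
  rw [dist_comm z v₁, dist_comm z v₂] at e₂
  rw [dist_comm (r₂ (r₁ z)) z] at e₃
  rw [hrange, Set.mem_ofPred_eq, ← Real.cosh_strictMonoOn.injOn.eq_iff (Set.mem_Ici.2 dist_nonneg)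
    (Set.mem_Ici.2 (mul_nonneg zero_le_two dist_nonneg)), hdouble]
  have e : Real.cosh (dist z (r₂ (r₁ z))) - (Real.cosh (dist v₁ v₂) ^ 2 +
      (Real.cosh (dist v₁ v₂) ^ 2 - 1)) =
      2 * ((Real.cosh (dist v₁ v₂) ^ 2 - 1) * (Real.cosh (dist v₁ z) ^ 2 - 1) -
        (Real.cosh (dist v₂ z) - Real.cosh (dist v₁ v₂) * Real.cosh (dist v₁ z)) ^ 2) := by
    linear_combination e₃ - e₁ + 2 * Real.cosh (dist v₂ z) * e₂
  constructor <;> intro h <;> linarith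
end

section
/- For s, u > 0 and θ ∈ (0, π), consider the elements of SL(2, ℝ): D(s) = [[exp(s/2), 0], [0, exp(−s/2)]], D(u) = [[exp(u/2), 0], [0, exp(−u/2)]], and K = [[cos(θ/2), sin(θ/2)], [−sin(θ/2), cos(θ/2)]], and set g = D(s) · (K · D(u) · K⁻¹). Then there exists t > 0 such that cosh(t/2) = cosh(s/2)·cosh(u/2) + sinh(s/2)·sinh(u/2)·cos θ, and t is the translation length of g on the hyperbolic plane: dist(z, g • z) ≥ t for all z ∈ ℍ, and dist(z, g • z) = t for some z ∈ ℍ. -/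
open UpperHalfPlane Real

/-- The diagonal element of `SL(2, ℝ)` acting on `ℍ` as the hyperbolic translation of
length `s` along the imaginary axis. -/
noncomputable def hypTranslation (s : ℝ) : Matrix.SpecialLinearGroup (Fin 2) ℝ :=
  ⟨!![Real.exp (s / 2), 0; 0, Real.exp (-(s / 2))], by
    simp [Matrix.det_fin_two_of, ← Real.exp_add]⟩

/-- The rotation element of `SL(2, ℝ)` fixing `i ∈ ℍ` which rotates the directions at `i`
by the angle `θ`. -/
noncomputable def hypRotation (θ : ℝ) : Matrix.SpecialLinearGroup (Fin 2) ℝ :=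
  ⟨!![Real.cos (θ / 2), Real.sin (θ / 2); -Real.sin (θ / 2), Real.cos (θ / 2)], by
    have := Real.sin_sq_add_cos_sq (θ / 2)
    simp [Matrix.det_fin_two_of]
    nlinarith⟩

/-- The displacement of a point of `ℍ` under `g ∈ SL(2, ℝ)`, in terms of the trace of `g` and a
defect which vanishes exactly on the axis of `g` when `g` is hyperbolic. -/
theorem cosh_half_dist_smul_sq (g : Matrix.SpecialLinearGroup (Fin 2) ℝ) (z : ℍ) :
    Real.cosh (dist z (g • z) / 2) ^ 2 = ((g 0 0 + g 1 1) / 2) ^ 2 +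
      ((g 1 0 * (z.re ^ 2 + z.im ^ 2) + (g 1 1 - g 0 0) * z.re - g 0 1) / (2 * z.im)) ^ 2 := by
  have hdet : g 0 0 * g 1 1 - g 0 1 * g 1 0 = 1 := by
    rw [← Matrix.det_fin_two, g.det_coe]
  have hy := z.im_pos
  have hw : (g 1 0 * (z : ℂ) + g 1 1 : ℂ) ≠ 0 := by
    intro h
    have him := congrArg Complex.im h
    have hre := congrArg Complex.re h
    simp [hy.ne'] at him hre
    simp [him] at hre
    simp [him, hre] at hdet
  have hN : 0 < Complex.normSq (g 1 0 * (z : ℂ) + g 1 1) := Complex.normSq_pos.2 hw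
  have him : (g • z).im = z.im / Complex.normSq (g 1 0 * (z : ℂ) + g 1 1) := by
    rw [MulAction.compHom_smul_def, UpperHalfPlane.im_smul_eq_div_normSq]
    simp [UpperHalfPlane.denom]
  have hcoe : ((g • z : ℍ) : ℂ) =
      (g 0 0 * (z : ℂ) + g 0 1) / (g 1 0 * (z : ℂ) + g 1 1) := by
    simpa using coe_specialLinearGroup_apply g z
  have hsub : (z : ℂ) - (g • z : ℍ) =
      (g 1 0 * (z : ℂ) ^ 2 + (g 1 1 - g 0 0) * z - g 0 1) / (g 1 0 * (z : ℂ) + g 1 1) := by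
    rw [hcoe, eq_div_iff hw, sub_mul, div_mul_cancel₀ _ hw]
    ring
  have hdist : dist (z : ℂ) (g • z : ℍ) ^ 2 =
      Complex.normSq (g 1 0 * (z : ℂ) ^ 2 + (g 1 1 - g 0 0) * z - g 0 1) /
        Complex.normSq (g 1 0 * (z : ℂ) + g 1 1) := by
    rw [dist_eq_norm, ← Complex.normSq_eq_norm_sq, hsub, Complex.normSq_div]
  have hcosh := cosh_dist z (g • z)
  rw [hdist, him] at hcosh
  have hhalf := Real.cosh_two_mul (dist z (g • z) / 2)
  rw [mul_div_cancel₀ _ (two_ne_zero' ℝ), Real.sinh_sq, hcosh] at hhalf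
  have hQ : Complex.normSq (g 1 0 * (z : ℂ) ^ 2 + (g 1 1 - g 0 0) * z - g 0 1) =
      (g 1 0 * (z.re ^ 2 + z.im ^ 2) + (g 1 1 - g 0 0) * z.re - g 0 1) ^ 2 +
        z.im ^ 2 * ((g 0 0 + g 1 1) ^ 2 - 4) := by
    simp [Complex.normSq_apply, pow_two]
    linear_combination (-4 * z.im ^ 2) * hdet
  rw [hQ] at hhalf
  field_simp at hhalf ⊢
  linarith

/-- An element of `SL(2, ℝ)` with trace of absolute value greater than `2` has an axis. -/
theorem exists_mem_axis (g : Matrix.SpecialLinearGroup (Fin 2) ℝ)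
    (hg : 4 < (g 0 0 + g 1 1) ^ 2) :
    ∃ z : ℍ, g 1 0 * (z.re ^ 2 + z.im ^ 2) + (g 1 1 - g 0 0) * z.re - g 0 1 = 0 := by
  have hdet : g 0 0 * g 1 1 - g 0 1 * g 1 0 = 1 := by
    rw [← Matrix.det_fin_two, g.det_coe]
  by_cases hc : g 1 0 = 0
  · have hne : g 1 1 - g 0 0 ≠ 0 := by
      intro h
      rw [hc] at hdet
      nlinarith
    refine ⟨⟨⟨g 0 1 / (g 1 1 - g 0 0), 1⟩, one_pos⟩, ?_⟩
    change g 1 0 * ((g 0 1 / (g 1 1 - g 0 0)) ^ 2 + 1 ^ 2) +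
      (g 1 1 - g 0 0) * (g 0 1 / (g 1 1 - g 0 0)) - g 0 1 = 0
    rw [hc]
    field_simp
    ring
  · have hpos : 0 < ((g 0 0 + g 1 1) ^ 2 - 4) / (4 * g 1 0 ^ 2) := by
      have : 0 < g 1 0 ^ 2 := by positivity
      apply div_pos <;> linarith
    refine ⟨⟨⟨(g 0 0 - g 1 1) / (2 * g 1 0), √(((g 0 0 + g 1 1) ^ 2 - 4) / (4 * g 1 0 ^ 2))⟩,
      Real.sqrt_pos.2 hpos⟩, ?_⟩
    change g 1 0 * (((g 0 0 - g 1 1) / (2 * g 1 0)) ^ 2 +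
      √(((g 0 0 + g 1 1) ^ 2 - 4) / (4 * g 1 0 ^ 2)) ^ 2) +
      (g 1 1 - g 0 0) * ((g 0 0 - g 1 1) / (2 * g 1 0)) - g 0 1 = 0
    rw [Real.sq_sqrt hpos.le]
    field_simp
    linear_combination 16 * hdet

/-- If `g ∈ SL(2, ℝ)` has trace `2 * cosh (t / 2)` with `t > 0`, then `t` is the least
displacement of `g` on `ℍ`. -/
theorem le_dist_smul_and_exists_dist_smul_eq (g : Matrix.SpecialLinearGroup (Fin 2) ℝ) {t : ℝ}
    (ht : 0 < t) (hg : g 0 0 + g 1 1 = 2 * Real.cosh (t / 2)) :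
    (∀ z : ℍ, t ≤ dist z (g • z)) ∧ ∃ z : ℍ, dist z (g • z) = t := by
  have hdisp := cosh_half_dist_smul_sq g
  rw [hg, mul_div_cancel_left₀ _ (two_ne_zero' ℝ)] at hdisp
  constructor
  · intro z
    have hle : Real.cosh (t / 2) ≤ Real.cosh (dist z (g • z) / 2) := by
      refine (sq_le_sq₀ (Real.cosh_pos _).le (Real.cosh_pos _).le).1 ?_
      rw [hdisp z]
      exact le_add_of_nonneg_right (sq_nonneg _)
    rw [Real.cosh_le_cosh, abs_of_pos (by positivity), abs_of_nonneg (by positivity)] at hle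
    linarith
  · have hone : 1 < Real.cosh (t / 2) := Real.one_lt_cosh.2 (by positivity)
    obtain ⟨z, hz⟩ := exists_mem_axis g (by rw [hg]; nlinarith)
    refine ⟨z, ?_⟩
    have heq := hdisp z
    rw [hz, zero_div, zero_pow two_ne_zero, add_zero,
      pow_left_inj₀ (Real.cosh_pos _).le (Real.cosh_pos _).le two_ne_zero] at heq
    have := Real.cosh_strictMonoOn.injOn (Set.mem_Ici.2 (by positivity))
      (Set.mem_Ici.2 (by positivity)) heq
    linarith

/-- The trace of the product of two hyperbolic translations whose axes meet at `i`. -/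
theorem trace_hypTranslation_mul_conj (s u θ : ℝ) :
    (hypTranslation s * (hypRotation θ * hypTranslation u * (hypRotation θ)⁻¹)) 0 0 +
        (hypTranslation s * (hypRotation θ * hypTranslation u * (hypRotation θ)⁻¹)) 1 1 =
      2 * (Real.cosh (s / 2) * Real.cosh (u / 2) +
        Real.sinh (s / 2) * Real.sinh (u / 2) * Real.cos θ) := by
  have hcos : Real.cos θ = 2 * Real.cos (θ / 2) ^ 2 - 1 := by
    rw [← Real.cos_two_mul, mul_div_cancel₀ _ (two_ne_zero' ℝ)]
  have hsin := Real.sin_sq (θ / 2)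
  simp only [Matrix.SpecialLinearGroup.coe_mul, Matrix.SpecialLinearGroup.coe_inv]
  simp [hypTranslation, hypRotation, Matrix.mul_apply, Fin.sum_univ_two, Matrix.adjugate_fin_two]
  rw [hcos, Real.cosh_eq, Real.cosh_eq, Real.sinh_eq, Real.sinh_eq]
  linear_combination (Real.exp (s / 2) * Real.exp (-(u / 2)) +
    Real.exp (-(s / 2)) * Real.exp (u / 2)) * hsin

/-- Beardon, Theorem 7.38.6 (Lemma 2.2 of the paper), in normalized position: if `g` is a
hyperbolic translation of length `s` along the imaginary axis and `h = K D(u) K⁻¹` is a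
hyperbolic translation of length `u` along an axis meeting the imaginary axis at `i` with
forward angle `θ ∈ (0, π)`, then `g * h` is hyperbolic with translation length `t`
determined by `cosh (t/2) = cosh (s/2) cosh (u/2) + sinh (s/2) sinh (u/2) cos θ`. -/
theorem translationLength_mul_of_intersecting_axes (s u θ : ℝ)
    (hs : 0 < s) (hu : 0 < u) (hθ : θ ∈ Set.Ioo 0 Real.pi) :
    ∃ t : ℝ, 0 < t ∧
      Real.cosh (t / 2)
        = Real.cosh (s / 2) * Real.cosh (u / 2)
          + Real.sinh (s / 2) * Real.sinh (u / 2) * Real.cos θ ∧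
      (∀ z : ℍ,
        t ≤ dist z ((hypTranslation s * (hypRotation θ * hypTranslation u * (hypRotation θ)⁻¹)) • z)) ∧
      (∃ z : ℍ,
        dist z ((hypTranslation s * (hypRotation θ * hypTranslation u * (hypRotation θ)⁻¹)) • z) = t) := by
  have hpos : 0 < Real.sinh (s / 2) * Real.sinh (u / 2) :=
    mul_pos (Real.sinh_pos_iff.2 (by positivity)) (Real.sinh_pos_iff.2 (by positivity))
  have hcos : -1 < Real.cos θ := by
    rw [← Real.cos_pi]
    exact Real.cos_lt_cos_of_nonneg_of_le_pi hθ.1.le le_rfl hθ.2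
  have hone : 1 < Real.cosh (s / 2) * Real.cosh (u / 2) +
      Real.sinh (s / 2) * Real.sinh (u / 2) * Real.cos θ := by
    have hsub := Real.one_le_cosh (s / 2 - u / 2)
    rw [Real.cosh_sub] at hsub
    nlinarith
  have hcosh := Real.cosh_arcosh hone.le
  have ht : 0 < 2 * Real.arcosh (Real.cosh (s / 2) * Real.cosh (u / 2) +
      Real.sinh (s / 2) * Real.sinh (u / 2) * Real.cos θ) :=
    mul_pos two_pos (Real.arcosh_pos hone)
  rw [← mul_div_cancel_left₀ (Real.arcosh _) (two_ne_zero' ℝ)] at hcosh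
  refine ⟨_, ht, hcosh, le_dist_smul_and_exists_dist_smul_eq _ ht ?_⟩
  rw [hcosh, trace_hypTranslation_mul_conj]
end

section
/- Let ℓx, ℓy, ℓz be positive real numbers, let φP, φQ ∈ (0, π), and let m₁, m₂ be distinct positive natural numbers. Suppose that for both m = m₁ and m = m₂ one has (cosh(m·ℓx/2)/sinh(m·ℓx/2))·cosh(ℓy/2) + sinh(ℓy/2)·cos φP = (cosh(m·ℓx/2)/sinh(m·ℓx/2))·cosh(ℓz/2) + sinh(ℓz/2)·cos φQ. Then ℓy = ℓz and φP = φQ. -/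
open Real

/-- The hyperbolic cotangent is injective on the positive reals. -/
theorem injOn_cosh_div_sinh :
    Set.InjOn (fun a : ℝ => Real.cosh a / Real.sinh a) (Set.Ioi 0) := by
  intro a ha b hb hab
  have hsa : Real.sinh a ≠ 0 := (Real.sinh_pos_iff.2 ha).ne'
  have hsb : Real.sinh b ≠ 0 := (Real.sinh_pos_iff.2 hb).ne'
  have hcross : Real.cosh a * Real.sinh b = Real.cosh b * Real.sinh a :=
    (div_eq_div_iff hsa hsb).1 hab
  have hsub : Real.sinh (a - b) = 0 := by
    rw [Real.sinh_sub]
    linarith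
  exact sub_eq_zero.1 (Real.sinh_eq_zero.1 hsub)

/-- The analytic core of Lemma 4.1: if the quantity
`coth (m ℓx / 2) * cosh (ℓy / 2) + sinh (ℓy / 2) * cos φP` agrees with
`coth (m ℓx / 2) * cosh (ℓz / 2) + sinh (ℓz / 2) * cos φQ` for two distinct positive
exponents `m = m₁, m₂`, then `ℓy = ℓz` and `φP = φQ`. -/
theorem lengths_and_angles_eq (ℓx ℓy ℓz : ℝ) (hx : 0 < ℓx) (hy : 0 < ℓy) (hz : 0 < ℓz)
    (φP φQ : ℝ) (hP : φP ∈ Set.Ioo 0 Real.pi) (hQ : φQ ∈ Set.Ioo 0 Real.pi)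
    (m₁ m₂ : ℕ) (hm₁ : 0 < m₁) (hm₂ : 0 < m₂) (hne : m₁ ≠ m₂)
    (h : ∀ m : ℕ, m = m₁ ∨ m = m₂ →
      Real.cosh (m * ℓx / 2) / Real.sinh (m * ℓx / 2) * Real.cosh (ℓy / 2)
          + Real.sinh (ℓy / 2) * Real.cos φP
        = Real.cosh (m * ℓx / 2) / Real.sinh (m * ℓx / 2) * Real.cosh (ℓz / 2)
          + Real.sinh (ℓz / 2) * Real.cos φQ) :
    ℓy = ℓz ∧ φP = φQ := by
  have hpos : ∀ m : ℕ, 0 < m → (0 : ℝ) < m * ℓx / 2 := fun m hm => by positivity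
  have hcoth : Real.cosh (m₁ * ℓx / 2) / Real.sinh (m₁ * ℓx / 2)
      ≠ Real.cosh (m₂ * ℓx / 2) / Real.sinh (m₂ * ℓx / 2) := by
    intro heq
    have hm := injOn_cosh_div_sinh (hpos m₁ hm₁) (hpos m₂ hm₂) heq
    have hm' : (m₁ : ℝ) = m₂ := mul_right_cancel₀ hx.ne' (by linarith)
    exact hne (by exact_mod_cast hm')
  have h₁ := h m₁ (Or.inl rfl)
  have h₂ := h m₂ (Or.inr rfl)
  have hcosh : Real.cosh (ℓy / 2) = Real.cosh (ℓz / 2) :=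
    mul_left_cancel₀ (sub_ne_zero.2 hcoth) (by linear_combination h₁ - h₂)
  have hlen : ℓy = ℓz := by
    have := Real.cosh_injOn (Set.mem_Ici.2 (half_pos hy).le) (Set.mem_Ici.2 (half_pos hz).le) hcosh
    linarith
  subst hlen
  have hcos : Real.cos φP = Real.cos φQ :=
    mul_left_cancel₀ (Real.sinh_pos_iff.2 (half_pos hy)).ne' (add_left_cancel h₁)
  exact ⟨rfl, Real.injOn_cos (Set.Ioo_subset_Icc_self hP) (Set.Ioo_subset_Icc_self hQ) hcos⟩
end

section
/- Let α be a type and let x be a nontrivial element of the free group FreeGroup α (x ≠ 1). If m and n are natural numbers such that x^m is conjugate to x^n in FreeGroup α, then m = n. -/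
namespace FreeGroup

open reduceCyclically

variable {α : Type*}

theorem norm_pow_of_ne_zero [DecidableEq α] (x : FreeGroup α) {k : ℕ} (hk : k ≠ 0) :
    norm (x ^ k) =
      k * (reduceCyclically x.toWord).length + 2 * (conjugator x.toWord).length := by
  simp only [norm, toWord_pow, reduce_flatten_replicate isReduced_toWord, hk, if_false,
    List.length_append, List.length_flatten, List.map_replicate, List.sum_replicate,
    invRev_length, smul_eq_mul]
  ring

theorem length_reduceCyclically_toWord_pos [DecidableEq α] {x : FreeGroup α} (hx : x ≠ 1) :
    0 < (reduceCyclically x.toWord).length := by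
  rw [List.length_pos_iff]
  intro h
  have hword := conj_conjugator_reduceCyclically x.toWord
  rw [h, List.append_nil] at hword
  apply hx
  rw [← mk_toWord (x := x), ← hword, ← mul_mk, ← inv_mk, mul_inv_cancel]

/-- The exponents are compared through the linear growth of `k ↦ norm (x ^ k)`, since conjugation
by `g` changes the norm by at most `2 * norm g`. -/
theorem le_of_isConj_pow {x : FreeGroup α} (hx : x ≠ 1) {m n : ℕ}
    (h : IsConj (x ^ m) (x ^ n)) : n ≤ m := by
  classical
  by_contra! hmn
  obtain ⟨g, hg⟩ := isConj_iff.mp h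
  rcases Nat.eq_zero_or_pos m with rfl | hm
  · rw [pow_zero, mul_one, mul_inv_cancel] at hg
    exact hx ((pow_eq_one_iff_left hmn.ne').mp hg.symm)
  set l := (reduceCyclically x.toWord).length with hl
  have hl_pos : 0 < l := length_reduceCyclically_toWord_pos hx
  set k := 2 * norm g + 1 with hk
  have hconj : x ^ (n * k) = g * x ^ (m * k) * g⁻¹ := by
    rw [pow_mul, ← hg, conj_pow, pow_mul]
  have hle : norm (x ^ (n * k)) ≤ norm g + norm (x ^ (m * k)) + norm g := by
    rw [hconj]
    refine (norm_mul_le _ _).trans ?_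
    rw [norm_inv_eq]
    gcongr
    exact norm_mul_le _ _
  rw [norm_pow_of_ne_zero x (mul_ne_zero (by omega) (by omega)),
    norm_pow_of_ne_zero x (mul_ne_zero hm.ne' (by omega)), ← hl] at hle
  have hgrow : (m + 1) * k * l ≤ n * k * l := by gcongr; exact hmn
  have hkl : k ≤ k * l := Nat.le_mul_of_pos_right k hl_pos
  linarith

end FreeGroup

/-- In a free group, if a nontrivial element `x` satisfies that `x ^ m` is conjugate to
`x ^ n` for natural numbers `m`, `n`, then `m = n`. -/
theorem FreeGroup.pow_isConj_pow_iff {α : Type*} (x : FreeGroup α) (hx : x ≠ 1)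
    (m n : ℕ) (h : IsConj (x ^ m) (x ^ n)) : m = n :=
  le_antisymm (FreeGroup.le_of_isConj_pow hx h.symm) (FreeGroup.le_of_isConj_pow hx h)
end

section
/- Let α be a type and let x be a nontrivial element of the free group FreeGroup α (x ≠ 1). Then x is not conjugate to x⁻¹ in FreeGroup α. -/
/-- In a group with unique roots, only the identity is conjugate to its own inverse. -/
theorem IsMulTorsionFree.eq_one_of_isConj_inv {G : Type*} [Group G] [IsMulTorsionFree G] {x : G}
    (h : IsConj x x⁻¹) : x = 1 := by
  obtain ⟨g, hg⟩ := isConj_iff.1 h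
  have h₁ : g * x = x⁻¹ * g := by rw [← hg, inv_mul_cancel_right]
  have h₂ : (g * x) ^ 2 = g ^ 2 := by
    calc (g * x) ^ 2 = g * x * (x⁻¹ * g) := by rw [← h₁, sq]
      _ = g ^ 2 := by rw [mul_assoc, mul_inv_cancel_left, sq]
  exact mul_eq_left.1 (pow_left_injective two_ne_zero h₂)

/-- In a free group, a nontrivial element is never conjugate to its inverse. -/
theorem FreeGroup.not_isConj_inv {α : Type*} (x : FreeGroup α) (hx : x ≠ 1) :
    ¬ IsConj x x⁻¹ := by
  exact fun h => hx (IsMulTorsionFree.eq_one_of_isConj_inv h)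
end

section
/- Let F = FreeGroup (Fin 2) with generators a = FreeGroup.of 0 and b = FreeGroup.of 1. For every natural number m ≥ 2, the elements w₁ = (b⁻¹ * a)^m * (a * b⁻¹) and w₂ = (a * b⁻¹)^m * (b⁻¹ * a) are not conjugate in F. -/
namespace FreeGroup

variable {α : Type*}

theorem IsReduced.mk_inj {L₁ L₂ : List (α × Bool)} (h₁ : IsReduced L₁) (h₂ : IsReduced L₂)
    (h : mk L₁ = mk L₂) : L₁ = L₂ := by
  classical
  rw [← h₁.reduce_eq, ← h₂.reduce_eq, ← toWord_mk, ← toWord_mk, h]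

theorem mk_singleton_not (x : α × Bool) : mk [(x.1, !x.2)] = (mk [x])⁻¹ := by
  simp [inv_mk, invRev]

theorem isReduced_append {L₁ L₂ : List (α × Bool)} :
    IsReduced (L₁ ++ L₂) ↔ IsReduced L₁ ∧ IsReduced L₂ ∧
      ∀ a ∈ L₁.getLast?, ∀ b ∈ L₂.head?, a.1 = b.1 → a.2 = b.2 :=
  List.isChain_append

theorem isCyclicallyReduced_concat_iff {x : α × Bool} {L : List (α × Bool)} :
    IsCyclicallyReduced (L ++ [x]) ↔ IsCyclicallyReduced (x :: L) := by
  trans IsReduced ([x] ++ (L ++ [x]))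
  · rw [isReduced_append, isCyclicallyReduced_iff]
    simp
  · rw [← List.append_assoc, isReduced_append, isCyclicallyReduced_iff]
    simp

/-- If two cyclically reduced words are conjugate by a reduced word, then one is a rotation of the
other. -/
theorem IsCyclicallyReduced.isRotated_of_mk_mul_eq {L₁ L₂ g : List (α × Bool)}
    (h₁ : IsCyclicallyReduced L₁) (h₂ : IsCyclicallyReduced L₂) (hg : IsReduced g)
    (h : mk g * mk L₁ = mk L₂ * mk g) : L₁ ~r L₂ := by
  induction hn : g.length generalizing g L₁ L₂ with
  | zero =>
    obtain rfl := List.eq_nil_of_length_eq_zero hn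
    rw [h₁.isReduced.mk_inj h₂.isReduced (by simpa [← one_eq_mk] using h)]
  | succ n ih =>
    by_cases hgL : IsReduced (g ++ L₁)
    · by_cases hLg : IsReduced (L₂ ++ g)
      · have key := hgL.mk_inj hLg (by simpa only [mul_mk] using h)
        obtain ⟨z, g, rfl⟩ := List.exists_cons_of_length_eq_add_one hn
        cases L₂ with
        | nil =>
          have : L₁ = [] := by simpa using congrArg List.length key
          rw [this]
        | cons w v =>
          obtain ⟨rfl, key'⟩ : z = w ∧ g ++ L₁ = v ++ z :: g := by simpa using key
          refine (ih h₁ (isCyclicallyReduced_concat_iff.2 h₂) (hg.infix (List.infix_cons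
            List.infix_rfl)) ?_ (by simpa using hn)).trans (List.isRotated_concat z v)
          simp [mul_mk, key']
      · obtain ⟨y, hy, z, hz, hyz, hne⟩ :
            ∃ y ∈ L₂.getLast?, ∃ z ∈ g.head?, y.1 = z.1 ∧ y.2 ≠ z.2 := by
          by_contra! hc
          exact hLg (isReduced_append.2 ⟨h₂.isReduced, hg, hc⟩)
        obtain ⟨v, rfl⟩ := List.getLast?_eq_some_iff.1 hy
        obtain ⟨g, rfl⟩ := List.head?_eq_some_iff.1 hz
        obtain rfl : z = (y.1, !y.2) := Prod.ext hyz.symm (by grind)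
        refine (ih h₁ (isCyclicallyReduced_concat_iff.1 h₂) (hg.infix (List.infix_cons
            List.infix_rfl)) ?_ (by simpa using hn)).trans (List.isRotated_concat y v).symm
        rw [← List.singleton_append (l := g), ← mul_mk, ← mul_mk, mk_singleton_not] at h
        rw [← List.singleton_append, ← mul_mk]
        calc mk g * mk L₁ = mk [y] * ((mk [y])⁻¹ * mk g * mk L₁) := by group
          _ = _ := by rw [h]; group
    · obtain ⟨z, hz, x, hx, hxz, hne⟩ :
          ∃ z ∈ g.getLast?, ∃ x ∈ L₁.head?, z.1 = x.1 ∧ z.2 ≠ x.2 := by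
        by_contra! hc
        exact hgL (isReduced_append.2 ⟨hg, h₁.isReduced, hc⟩)
      obtain ⟨g, rfl⟩ := List.getLast?_eq_some_iff.1 hz
      obtain ⟨u, rfl⟩ := List.head?_eq_some_iff.1 hx
      obtain rfl : z = (x.1, !x.2) := Prod.ext hxz (by grind)
      refine (List.isRotated_concat x u).symm.trans (ih (isCyclicallyReduced_concat_iff.2 h₁) h₂
        (hg.infix (List.prefix_append _ _).isInfix) ?_ (by simpa using hn))
      rw [← mul_mk, mk_singleton_not, ← List.singleton_append (l := u), ← mul_mk] at h
      rw [← mul_mk]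
      calc mk g * (mk u * mk [x]) = mk g * (mk [x])⁻¹ * (mk [x] * mk u) * mk [x] := by group
        _ = _ := by rw [h]; group

theorem IsCyclicallyReduced.isRotated_of_isConj {L₁ L₂ : List (α × Bool)}
    (h₁ : IsCyclicallyReduced L₁) (h₂ : IsCyclicallyReduced L₂) (h : IsConj (mk L₁) (mk L₂)) :
    L₁ ~r L₂ := by
  classical
  obtain ⟨c, hc⟩ := h
  refine h₁.isRotated_of_mk_mul_eq h₂ (isReduced_toWord (x := (c : FreeGroup α))) ?_
  rw [mk_toWord]
  exact hc

/-- A word in which each generator occurs with only one sign is cyclically reduced. -/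
theorem isCyclicallyReduced_of_forall_mem {L : List (α × Bool)} {s : α → Bool}
    (h : ∀ x ∈ L, x.2 = s x.1) : IsCyclicallyReduced L := by
  refine ⟨List.Pairwise.isChain (List.pairwise_iff_forall_sublist.2 fun {a b} hab hs => ?_),
    fun a ha b hb hs => ?_⟩
  · rw [h a (hab.subset (by simp)), h b (hab.subset (by simp)), hs]
  · rw [h a (List.mem_of_getLast? ha), h b (List.mem_of_head? hb), hs]

end FreeGroup

theorem List.getElem?_flatten_replicate_pair {β : Type*} (x y : β) (m j : ℕ) :
    (List.replicate m [x, y]).flatten[j]? =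
      if j < 2 * m then some (if j % 2 = 0 then x else y) else none := by
  induction m generalizing j with
  | zero => simp
  | succ m ih =>
    rw [List.replicate_succ, List.flatten_cons]
    match j with
    | 0 => simp
    | 1 => simp; omega
    | j + 2 =>
      simp only [List.cons_append, List.nil_append, List.getElem?_cons_succ, ih]
      simp [mul_add]

theorem List.getElem?_flatten_replicate_pair_append {β : Type*} (x y : β) (m j : ℕ) :
    ((List.replicate m [x, y]).flatten ++ [y, x])[j]? =
      if j < 2 * m then some (if j % 2 = 0 then x else y) else
      if j = 2 * m then some y else if j = 2 * m + 1 then some x else none := by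
  rw [List.getElem?_append, List.getElem?_flatten_replicate_pair]
  have hl : (List.replicate m [x, y]).flatten.length = 2 * m := by simp [mul_comm]
  rw [hl]
  by_cases h : j < 2 * m
  · simp [h]
  · obtain ⟨k, rfl⟩ := Nat.exists_eq_add_of_le (not_lt.1 h)
    match k with
    | 0 => simp
    | 1 => simp
    | k + 2 => simp

theorem List.not_isRotated_flatten_replicate_pair_append {β : Type*} {x y : β} (hxy : x ≠ y)
    {m : ℕ} (hm : 2 ≤ m) :
    ¬ ((List.replicate m [y, x]).flatten ++ [x, y]) ~r
      ((List.replicate m [x, y]).flatten ++ [y, x]) := by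
  rintro ⟨k, hk⟩
  have hl : ((List.replicate m [y, x]).flatten ++ [x, y]).length = 2 * m + 2 := by simp [mul_comm]
  have key (j : ℕ) (hj : j < 2 * m + 2) := List.getElem?_rotate (n := k) (hl ▸ hj)
  simp only [hk, hl, List.getElem?_flatten_replicate_pair_append] at key
  have hlt : (2 * m + 1 + k) % (2 * m + 2) < 2 * m + 2 := Nat.mod_lt _ (by omega)
  obtain ⟨i, hi⟩ : ∃ i, i = (2 * m + 1 + k) % (2 * m + 2) := ⟨_, rfl⟩
  have shift (c : ℕ) : (c + k) % (2 * m + 2) = (i + (c + 1)) % (2 * m + 2) := by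
    rw [hi, Nat.mod_add_mod, show 2 * m + 1 + k + (c + 1) = c + k + (2 * m + 2) by ring,
      Nat.add_mod_right]
  have h₀ := key (2 * m + 1) (by omega)
  have h₁ := key 0 (by omega)
  have h₃ := key 2 (by omega)
  rw [← hi] at h₀ hlt
  rw [shift] at h₁ h₃
  have hi' : i + 1 = 2 * m := by
    rcases (by omega : i < 2 * m ∨ i = 2 * m ∨ i = 2 * m + 1) with hi | hi | hi
    · have : (i + (0 + 1)) % (2 * m + 2) = i + 1 := Nat.mod_eq_of_lt (by omega)
      rw [this] at h₁
      grind
    · have : (i + (0 + 1)) % (2 * m + 2) = i + 1 := Nat.mod_eq_of_lt (by omega)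
      rw [this] at h₁
      grind
    · grind
  have : (i + (2 + 1)) % (2 * m + 2) = 0 := by
    rw [show i + (2 + 1) = 2 * m + 2 by omega, Nat.mod_self]
  rw [this] at h₃
  grind

/-- In the free group on two generators `a = FreeGroup.of 0` and `b = FreeGroup.of 1`
(the fundamental group of a pair of pants), for every `m ≥ 2` the words
`(b⁻¹ a)^m (a b⁻¹)` and `(a b⁻¹)^m (b⁻¹ a)` are not conjugate.  This shows that the
Goldman bracket `[x^m, x]` of the figure-eight class `x` on a pair of pants is nonzero. -/
theorem pairOfPants_words_not_isConj (m : ℕ) (hm : 2 ≤ m) :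
    ¬ IsConj
      (((FreeGroup.of 1 : FreeGroup (Fin 2))⁻¹ * FreeGroup.of 0) ^ m
        * (FreeGroup.of 0 * (FreeGroup.of 1)⁻¹))
      (((FreeGroup.of 0 : FreeGroup (Fin 2)) * (FreeGroup.of 1)⁻¹) ^ m
        * ((FreeGroup.of 1)⁻¹ * FreeGroup.of 0)) := by
  intro h
  have hs {m : ℕ} {x y : Fin 2 × Bool} (hx : x.2 = ![true, false] x.1)
      (hy : y.2 = ![true, false] y.1) :
      FreeGroup.IsCyclicallyReduced ((List.replicate m [x, y]).flatten ++ [y, x]) := by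
    refine FreeGroup.isCyclicallyReduced_of_forall_mem (s := ![true, false]) fun z hz => ?_
    have : z = x ∨ z = y := by
      simp at hz; grind
    rcases this with rfl | rfl <;> assumption
  refine List.not_isRotated_flatten_replicate_pair_append
    (x := ((0 : Fin 2), true)) (y := (1, false)) (by simp) hm
    (FreeGroup.IsCyclicallyReduced.isRotated_of_isConj (hs rfl rfl) (hs rfl rfl) ?_)
  rw [← FreeGroup.mul_mk, ← FreeGroup.mul_mk, ← FreeGroup.pow_mk, ← FreeGroup.pow_mk]
  exact h
end
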